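/- Let f ∈ R be a nonzero element and write f̂' for the image of f in R̂' (under the composite R → R' → R̂'). If x ∈ R̂' satisfies f̂'^i · x ∈ π̂(H)·R̂' for some natural number i (where π̂(H)·R̂' is the ideal of R̂' generated by the image of H), then x ∈ H'. In other words, the strict transform (saturation of H·R̂' with respect to powers of f̂') is contained in the implicit ideal H'. -/

import Mathlib

/-!
Statement context. Let `(R, M)` be a noetherian local domain which is not a field, with field of
fractions `K`, and let `ν : K → ℝ≥0` be a (multiplicatively written) valuation which is ≤ 1 on `R`
and < 1 on `M` (i.e. `ν` is a nontrivial rank-one valuation centered at `R`).  For `γ ∈ ℝ≥0` let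
`𝒫_γ = {x ∈ R | ν x ≤ γ}` and let `Φ = ν(R \ {0})`.  Then the implicit ideal
`H = ⋂_{γ ∈ Φ} 𝒫_γ·R̂` of the `M`-adic completion `R̂` of `R` is prime.
-/

open IsLocalRing
open scoped NNReal

/-- The valuation ideal `𝒫_γ = {x ∈ R | ν (f x) ≤ γ}`, for a valuation `ν` on a ring `K`
and a ring homomorphism `f : R → K` such that `ν ∘ f` is bounded by `1` on `R`. -/
def valIdeal {R K : Type*} [CommRing R] [CommRing K] (f : R →+* K)
    (ν : Valuation K ℝ≥0) (hν : ∀ x : R, ν (f x) ≤ 1) (γ : ℝ≥0) : Ideal R where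
  carrier := {x : R | ν (f x) ≤ γ}
  add_mem' := fun {a b} ha hb => by
    simp only [Set.mem_setOf_eq, map_add] at *
    exact le_trans (ν.map_add _ _) (max_le ha hb)
  zero_mem' := by simp
  smul_mem' := fun c x hx => by
    simp only [smul_eq_mul, Set.mem_setOf_eq, map_mul] at *
    calc ν (f c) * ν (f x) ≤ 1 * γ := mul_le_mul' (hν c) hx
      _ = γ := one_mul γ

/-- The value semigroup `Φ = ν(R \ {0})`. -/
def valSemigroup {R K : Type*} [CommRing R] [CommRing K] (f : R →+* K)
    (ν : Valuation K ℝ≥0) : Set ℝ≥0 :=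
  {γ : ℝ≥0 | ∃ x : R, x ≠ 0 ∧ ν (f x) = γ}

/-- The implicit ideal `H = ⋂_{γ ∈ Φ} 𝒫_γ·R̂` of the `M`-adic completion `R̂` of a local
ring `R`. -/
noncomputable def implicitIdeal {R K : Type*} [CommRing R] [IsLocalRing R] [CommRing K]
    (f : R →+* K) (ν : Valuation K ℝ≥0) (hν : ∀ x : R, ν (f x) ≤ 1) :
    Ideal (AdicCompletion (maximalIdeal R) R) :=
  ⨅ γ ∈ valSemigroup f ν,
    Ideal.map (algebraMap R (AdicCompletion (maximalIdeal R) R)) (valIdeal f ν hν γ)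

/-- If `π(M) ⊆ M'` then `M^n ≤ (M'^n).comap π`. -/
theorem pow_le_comap_pow {R R' : Type*} [CommRing R] [CommRing R'] {M : Ideal R} {M' : Ideal R'}
    (π : R →+* R') (h : ∀ x ∈ M, π x ∈ M') (n : ℕ) : M ^ n ≤ (M' ^ n).comap π := by
  rw [← Ideal.map_le_iff_le_comap, Ideal.map_pow]
  exact Ideal.pow_right_mono (Ideal.map_le_iff_le_comap.mpr h) n

/-- `πhat : R̂ → R̂'` is *the* ring homomorphism induced on the `M`-adic (resp. `M'`-adic)
completions by a local homomorphism `π : R → R'`: it is characterized by its compatibility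
with the canonical projections `R̂ → R/Mⁿ`, `R̂' → R'/M'ⁿ` and the homomorphisms
`R/Mⁿ → R'/M'ⁿ` induced by `π` (such a compatible homomorphism is unique, because an element
of an adic completion is determined by its images in all the quotients). -/
def IsInducedCompletionHom {R R' : Type*} [CommRing R] [CommRing R']
    [IsLocalRing R] [IsLocalRing R']
    (π : R →+* R') (hπ : ∀ x ∈ maximalIdeal R, π x ∈ maximalIdeal R')
    (πhat : AdicCompletion (maximalIdeal R) R →+* AdicCompletion (maximalIdeal R') R') : Prop :=
  ∀ (n : ℕ) (x : AdicCompletion (maximalIdeal R) R),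
    AdicCompletion.evalₐ (maximalIdeal R') n (πhat x) =
      Ideal.quotientMap ((maximalIdeal R') ^ n) π (pow_le_comap_pow π hπ n)
        (AdicCompletion.evalₐ (maximalIdeal R) n x)

namespace AdicCompletion

variable {R : Type*} [CommRing R] {I : Ideal R}

theorem mem_map_pow_of_evalₐ_eq_zero (hI : I.FG) {n : ℕ} {x : AdicCompletion I R}
    (hx : evalₐ I n x = 0) : x ∈ (I ^ n).map (algebraMap R (AdicCompletion I R)) := by
  have hker : x ∈ (eval I R n).ker := by
    rw [LinearMap.mem_ker, ← factor_evalₐ_eq_eval I x (by simp), hx, _root_.map_zero]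
  rw [← pow_smul_top_eq_ker_eval hI] at hker
  rwa [Ideal.smul_top_eq_map] at hker

/-- An ideal `J` containing a power `I ^ n` extends to the `I`-adic completion as the preimage
of `J / I ^ n`. -/
theorem mem_map_algebraMap_iff_of_pow_le (hI : I.FG) {n : ℕ} {J : Ideal R} (hJ : I ^ n ≤ J)
    {x : AdicCompletion I R} {y : R} (hxy : evalₐ I n x = Ideal.Quotient.mk (I ^ n) y) :
    x ∈ J.map (algebraMap R (AdicCompletion I R)) ↔ y ∈ J := by
  have heval : ∀ r : R, evalₐ I n (algebraMap R (AdicCompletion I R) r) =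
      Ideal.Quotient.mk (I ^ n) r := (evalₐ I n).commutes
  constructor
  · intro hx
    rw [← Ideal.mem_quotient_iff_mem hJ, ← hxy]
    have hcomp : ((evalₐ I n : AdicCompletion I R →+* R ⧸ I ^ n).comp
        (algebraMap R (AdicCompletion I R))) = Ideal.Quotient.mk (I ^ n) := RingHom.ext heval
    rw [← hcomp, ← Ideal.map_map]
    exact Ideal.mem_map_of_mem _ hx
  · intro hy
    have hsub : x - algebraMap R _ y ∈ (I ^ n).map (algebraMap R (AdicCompletion I R)) :=
      mem_map_pow_of_evalₐ_eq_zero hI (by rw [map_sub, hxy, heval, sub_self])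
    rw [← sub_add_cancel x (algebraMap R _ y)]
    exact add_mem (Ideal.map_mono hJ hsub) (Ideal.mem_map_of_mem _ hy)

end AdicCompletion

section valIdeal

variable {R K : Type*} [CommRing R] [CommRing K] {f : R →+* K} {ν : Valuation K ℝ≥0}
  (hν : ∀ x : R, ν (f x) ≤ 1)

theorem mem_valIdeal {γ : ℝ≥0} {x : R} : x ∈ valIdeal f ν hν γ ↔ ν (f x) ≤ γ := Iff.rfl

theorem valIdeal_mono {γ δ : ℝ≥0} (h : γ ≤ δ) : valIdeal f ν hν γ ≤ valIdeal f ν hν δ :=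
  fun _ hx => le_trans hx h

theorem exists_valuation_pow_le {x : R} (hx : ν (f x) < 1) {γ : ℝ≥0} (hγ : 0 < γ) :
    ∃ n : ℕ, ν (f (x ^ n)) ≤ γ := by
  obtain ⟨n, hn⟩ := exists_pow_lt_of_lt_one hγ hx
  exact ⟨n, by simpa using hn.le⟩

theorem exists_pow_le_valIdeal {I : Ideal R} (hI : I.FG) (hνI : ∀ x ∈ I, ν (f x) < 1)
    {γ : ℝ≥0} (hγ : 0 < γ) : ∃ n : ℕ, I ^ n ≤ valIdeal f ν hν γ :=
  Ideal.exists_pow_le_of_le_radical_of_fg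
    (fun x hx => exists_valuation_pow_le (hνI x hx) hγ) hI

end valIdeal

/-- Extended valuation ideals of positive value are compatible with division by ring elements. -/
theorem mem_map_valIdeal_of_mul_mem {R K : Type*} [CommRing R] [CommRing K] [IsLocalRing R]
    [IsNoetherianRing R] {f : R →+* K} {ν : Valuation K ℝ≥0} (hν : ∀ x : R, ν (f x) ≤ 1)
    (hνM : ∀ x ∈ maximalIdeal R, ν (f x) < 1) {g : R} (hg : ν (f g) ≠ 0)
    {γ : ℝ≥0} (hγ : γ ≠ 0) {x : AdicCompletion (maximalIdeal R) R}
    (hx : algebraMap R (AdicCompletion (maximalIdeal R) R) g * x ∈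
      (valIdeal f ν hν (ν (f g) * γ)).map (algebraMap R _)) :
    x ∈ (valIdeal f ν hν γ).map (algebraMap R (AdicCompletion (maximalIdeal R) R)) := by
  have hM : (maximalIdeal R).FG := (maximalIdeal R).fg_of_isNoetherianRing
  obtain ⟨n, hn⟩ := exists_pow_le_valIdeal hν hM hνM (pos_iff_ne_zero.mpr (mul_ne_zero hg hγ))
  obtain ⟨y, hy⟩ := Ideal.Quotient.mk_surjective (AdicCompletion.evalₐ (maximalIdeal R) n x)
  have hgy : g * y ∈ valIdeal f ν hν (ν (f g) * γ) := by
    refine (AdicCompletion.mem_map_algebraMap_iff_of_pow_le hM hn ?_).mp hx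
    rw [map_mul, map_mul, hy]
    exact congrArg (· * _) ((AdicCompletion.evalₐ (maximalIdeal R) n).commutes g)
  have hle : ν (f g) * γ ≤ γ := mul_le_of_le_one_left' (hν g)
  rw [AdicCompletion.mem_map_algebraMap_iff_of_pow_le hM (hn.trans (valIdeal_mono hν hle)) hy.symm,
    mem_valIdeal]
  rw [mem_valIdeal, map_mul, map_mul] at hgy
  exact le_of_mul_le_mul_left hgy (pos_iff_ne_zero.mpr hg)

theorem IsInducedCompletionHom.comp_algebraMap {R R' : Type*} [CommRing R] [CommRing R']
    [IsLocalRing R] [IsLocalRing R'] {π : R →+* R'}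
    {hπ : ∀ x ∈ maximalIdeal R, π x ∈ maximalIdeal R'}
    {πhat : AdicCompletion (maximalIdeal R) R →+* AdicCompletion (maximalIdeal R') R'}
    (h : IsInducedCompletionHom π hπ πhat) :
    πhat.comp (algebraMap R _) = (algebraMap R' _).comp π := by
  refine RingHom.ext fun r => AdicCompletion.ext_evalₐ fun n => ?_
  have h₁ : AdicCompletion.evalₐ (maximalIdeal R) n (algebraMap R _ r) =
      Ideal.Quotient.mk _ r := (AdicCompletion.evalₐ (maximalIdeal R) n).commutes r
  have h₂ : AdicCompletion.evalₐ (maximalIdeal R') n (algebraMap R' _ (π r)) =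
      Ideal.Quotient.mk _ (π r) := (AdicCompletion.evalₐ (maximalIdeal R') n).commutes (π r)
  rw [RingHom.comp_apply, RingHom.comp_apply, h n, h₁, h₂, Ideal.quotientMap_mk]

/-- If `ν ∘ π` takes a nonzero value at most `γ` on `R`, then `H·R̂'` lies in the extended
valuation ideal of `R'` for `γ`. -/
theorem map_implicitIdeal_le {R R' K : Type*} [CommRing R] [CommRing R'] [CommRing K]
    [IsLocalRing R] [IsLocalRing R'] {π : R →+* R'}
    {hπ : ∀ x ∈ maximalIdeal R, π x ∈ maximalIdeal R'}
    {πhat : AdicCompletion (maximalIdeal R) R →+* AdicCompletion (maximalIdeal R') R'}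
    (h : IsInducedCompletionHom π hπ πhat) {f : R' →+* K} {ν : Valuation K ℝ≥0}
    (hν : ∀ x : R', ν (f x) ≤ 1) {γ : ℝ≥0} {r : R} (hr : r ≠ 0) (hrγ : ν (f (π r)) ≤ γ) :
    (implicitIdeal (f.comp π) ν (fun x => hν (π x))).map πhat ≤
      (valIdeal f ν hν γ).map (algebraMap R' _) := by
  have hle := iInf₂_le (f := fun γ _ => Ideal.map (algebraMap R
    (AdicCompletion (maximalIdeal R) R)) (valIdeal (f.comp π) ν (fun x => hν (π x)) γ))
    (ν (f (π r))) (show _ ∈ valSemigroup (f.comp π) ν from ⟨r, hr, rfl⟩)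
  refine (Ideal.map_mono hle).trans ?_
  rw [Ideal.map_map, h.comp_algebraMap, ← Ideal.map_map]
  exact Ideal.map_mono (Ideal.map_le_iff_le_comap.mpr fun a ha => le_trans ha hrγ)

/-- Let `f ∈ R` be nonzero and let `f̂'` be the image of `f` in `R̂'` (under
the composite `R → R' → R̂'`).  If `x ∈ R̂'` satisfies `f̂'^i · x ∈ π̂(H)·R̂'` for some natural
number `i`, then `x ∈ H'`: the strict transform of the implicit ideal `H` (the saturation of
`H·R̂'` with respect to powers of `f̂'`) is contained in the implicit ideal `H'`. -/
theorem strict_transform_le_implicitIdeal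
    (R R' : Type*) [CommRing R] [CommRing R'] [IsDomain R] [IsDomain R']
    [IsNoetherianRing R] [IsNoetherianRing R'] [IsLocalRing R] [IsLocalRing R']
    (hR : ¬ IsField R) (hR' : ¬ IsField R')
    (π : R →+* R') (hinj : Function.Injective π)
    (hloc : ∀ x ∈ maximalIdeal R, π x ∈ maximalIdeal R')
    (ν' : Valuation (FractionRing R') ℝ≥0)
    (hν'1 : ∀ x : R', ν' (algebraMap R' (FractionRing R') x) ≤ 1)
    (hν'2 : ∀ x ∈ maximalIdeal R', ν' (algebraMap R' (FractionRing R') x) < 1)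
    (πhat : AdicCompletion (maximalIdeal R) R →+* AdicCompletion (maximalIdeal R') R')
    (hπhat : IsInducedCompletionHom π hloc πhat)
    (f : R) (hf : f ≠ 0)
    (x : AdicCompletion (maximalIdeal R') R') (i : ℕ)
    (hx : (algebraMap R' (AdicCompletion (maximalIdeal R') R') (π f)) ^ i * x ∈
        Ideal.map πhat
          (implicitIdeal ((algebraMap R' (FractionRing R')).comp π) ν'
            (fun x => hν'1 (π x)))) :
    x ∈ implicitIdeal (algebraMap R' (FractionRing R')) ν' hν'1 := by
  have hne : ∀ y : R', y ≠ 0 → ν' (algebraMap R' (FractionRing R') y) ≠ 0 := fun y hy =>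
    ν'.ne_zero_iff.mpr ((map_ne_zero_iff _ (IsFractionRing.injective R' (FractionRing R'))).mpr hy)
  obtain ⟨m, hm, hm0⟩ := Submodule.exists_mem_ne_zero_of_ne_bot
    (mt IsLocalRing.isField_iff_maximalIdeal_eq.mpr hR)
  have hg := hne _ (pow_ne_zero i ((map_ne_zero_iff π hinj).mpr hf))
  simp only [implicitIdeal, Ideal.mem_iInf]
  rintro _ ⟨b, hb, rfl⟩
  refine mem_map_valIdeal_of_mul_mem hν'1 hν'2 hg (hne b hb) ?_
  obtain ⟨n, hn⟩ := exists_valuation_pow_le (f := (algebraMap R' (FractionRing R')).comp π)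
    (hν'2 _ (hloc m hm)) (pos_iff_ne_zero.mpr (mul_ne_zero hg (hne b hb)))
  rw [map_pow (algebraMap R' (AdicCompletion (maximalIdeal R') R'))]
  exact map_implicitIdeal_le hπhat hν'1 (pow_ne_zero n hm0) hn hx
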